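/- arXiv:1602.02632 — 3 statements merged into one kernel-verified Lean document; each statement's English description precedes it below -/
import Mathlib

section
/- For every prime p > 7, p^7 divides 60 - 54*C(2p, p) + 20*C(3p, p) - 3*C(4p, p). -/
open Polynomial Finset

/-- The rising product `(X + 1)(X + 2) ⋯ (X + n)`. -/
noncomputable def risingProd (R : Type*) [CommRing R] (n : ℕ) : R[X] :=
  ∏ j ∈ range n, (X + C ((j : R) + 1))

lemma risingProd_eval {R : Type*} [CommRing R] (n : ℕ) (x : R) :
    (risingProd R n).eval x = ∏ j ∈ range n, (x + ((j : R) + 1)) := by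
  simp [risingProd, eval_prod]

lemma risingProd_eval_reflect {R : Type*} [CommRing R] {n : ℕ} (hn : Even n) (x : R) :
    (risingProd R n).eval (-((n : R) + 1) - x) = (risingProd R n).eval x := by
  have h : ∀ j ∈ range n, -((n : R) + 1) - x + ((j : R) + 1)
      = -1 * (x + (((n - 1 - j : ℕ) : R) + 1)) := by
    intro j hj
    have hj' := mem_range.mp hj
    have : ((n - 1 - j : ℕ) : R) = n - 1 - j := by
      rw [Nat.cast_sub (by omega), Nat.cast_sub (by omega), Nat.cast_one]
    rw [this]
    ring
  rw [risingProd_eval, risingProd_eval, prod_congr rfl h, prod_mul_distrib, prod_const,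
    card_range, hn.neg_one_pow, one_mul,
    prod_range_reflect (fun j => x + ((j : R) + 1)) n]

lemma risingProd_zmod (p : ℕ) [Fact p.Prime] :
    risingProd (ZMod p) (p - 1) = X ^ (p - 1) - 1 := by
  have hp : p.Prime := Fact.out
  have hp1 : 0 < p - 1 := Nat.sub_pos_of_lt hp.one_lt
  have hm : (risingProd (ZMod p) (p - 1)).Monic :=
    monic_prod_of_monic _ _ fun j _ => monic_X_add_C _
  have hd : (risingProd (ZMod p) (p - 1)).degree = (p - 1 : ℕ) := by
    simp only [risingProd, degree_prod, degree_X_add_C]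
    simp
  have hd' : (X ^ (p - 1) - 1 : (ZMod p)[X]).degree = (p - 1 : ℕ) := by
    simpa using degree_X_pow_sub_C hp1 (1 : ZMod p)
  have hm' : (X ^ (p - 1) - 1 : (ZMod p)[X]).Monic := by
    simpa using monic_X_pow_sub_C (1 : ZMod p) hp1.ne'
  refine eq_of_degree_sub_lt_of_eval_finset_eq (univ.erase 0) ?_ ?_
  · have hc : #(univ.erase (0 : ZMod p)) = p - 1 := by
      simp [card_erase_of_mem, ZMod.card]
    rw [hc, ← hd]
    exact degree_sub_lt_left (hd.trans hd'.symm) hm.ne_zero (hm.trans hm'.symm)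
  · intro x hx
    have hx0 : x ≠ 0 := (mem_erase.mp hx).1
    obtain ⟨j, hj, hj0⟩ : ∃ j ∈ range (p - 1), x + ((j : ZMod p) + 1) = 0 := by
      have h1 : 0 < (-x).val := Nat.pos_of_ne_zero (by simpa [ZMod.val_eq_zero] using hx0)
      have h2 := ZMod.val_lt (-x)
      refine ⟨(-x).val - 1, mem_range.mpr (by omega), ?_⟩
      rw [Nat.cast_sub h1]
      simp
    rw [risingProd_eval, prod_eq_zero hj hj0]
    simp [ZMod.pow_card_sub_one_eq_one hx0]

lemma prime_dvd_risingProd_coeff {p k : ℕ} (hp : p.Prime) (hk : 0 < k) (hkp : k < p - 1) :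
    (p : ℤ) ∣ (risingProd ℤ (p - 1)).coeff k := by
  have : Fact p.Prime := ⟨hp⟩
  have hmap : (risingProd ℤ (p - 1)).map (Int.castRingHom (ZMod p))
      = risingProd (ZMod p) (p - 1) := by
    simp [risingProd, Polynomial.map_prod]
  have h := congrArg (fun q => q.coeff k) (hmap.trans (risingProd_zmod p))
  rw [← ZMod.intCast_zmod_eq_zero_iff_dvd]
  simpa [coeff_map, coeff_X_pow, coeff_one, hkp.ne, hk.ne'] using h

lemma exists_eval_eq_sum_coeff_add {R : Type*} [CommRing R] (f : R[X]) (n : ℕ) :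
    ∃ q : R[X], ∀ x, f.eval x = ∑ i ∈ range n, f.coeff i * x ^ i + x ^ n * q.eval x := by
  obtain ⟨q, hq⟩ : X ^ n ∣ f - ∑ i ∈ range n, C (f.coeff i) * X ^ i := by
    rw [X_pow_dvd_iff]
    intro d hd
    simp [coeff_X_pow, hd]
  refine ⟨q, fun x => ?_⟩
  have h := congrArg (eval x) hq
  simp only [eval_sub, eval_finsetSum, eval_mul, eval_C, eval_pow, eval_X] at h
  linear_combination h

lemma factorial_mul_choose_eq {p : ℕ} (hp : 0 < p) (k : ℕ) :
    ((p - 1).factorial : ℤ) * (((k + 1) * p).choose p : ℤ)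
      = (k + 1) * (risingProd ℤ (p - 1)).eval ((k : ℤ) * p) := by
  obtain ⟨n, rfl⟩ : ∃ n, p = n + 1 := ⟨p - 1, by omega⟩
  have h1 := Nat.add_one_mul_choose_eq (k * (n + 1) + n) n
  have h2 := Nat.ascFactorial_eq_factorial_mul_choose (k * (n + 1)) n
  rw [Nat.ascFactorial_eq_prod_range] at h2
  have h3 : (k + 1) * (n + 1) = k * (n + 1) + n + 1 := by ring
  have h4 : (risingProd ℤ n).eval ((k : ℤ) * (n + 1 : ℕ))
      = n.factorial * ((k * (n + 1) + n).choose n : ℤ) := by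
    rw [risingProd_eval]
    zify at h2
    rw [← h2]
    refine prod_congr rfl fun j _ => ?_
    push_cast
    ring
  rw [Nat.add_sub_cancel, h4, h3]
  zify at h1
  refine mul_right_cancel₀ (b := (n : ℤ) + 1) (by positivity) ?_
  linear_combination (-(n.factorial : ℤ)) * h1

/-- The weights `-1, 5, -9, 5, 5, -9, 5, -1` at `-4, …, 3` annihilate polynomials of degree at
most five. -/
lemma prime_pow_seven_dvd_risingProd {p : ℕ} (hp : p.Prime) (h : 7 < p) :
    (p : ℤ) ^ 7 ∣ 5 * (risingProd ℤ (p - 1)).eval 0 - 9 * (risingProd ℤ (p - 1)).eval (p : ℤ)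
      + 5 * (risingProd ℤ (p - 1)).eval (2 * p : ℤ)
      - (risingProd ℤ (p - 1)).eval (3 * p : ℤ) := by
  have hodd : Odd p := hp.odd_of_ne_two (by omega)
  have heven : Even (p - 1) := Nat.Odd.sub_odd hodd odd_one
  set f := risingProd ℤ (p - 1)
  have hrefl : ∀ x : ℤ, f.eval (-(p : ℤ) - x) = f.eval x := by
    intro x
    have := risingProd_eval_reflect (R := ℤ) heven x
    rwa [Nat.cast_sub hp.one_lt.le, Nat.cast_one, sub_add_cancel] at this
  obtain ⟨c, hc⟩ : (p : ℤ) ∣ f.coeff 6 :=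
    prime_dvd_risingProd_coeff hp (by norm_num) (by omega)
  obtain ⟨q, hq⟩ := exists_eval_eq_sum_coeff_add f 7
  have hcop : IsCoprime ((p : ℤ) ^ 7) 2 := by
    refine IsCoprime.pow_left ?_
    exact_mod_cast Nat.isCoprime_iff_coprime.mpr hodd.coprime_two_right
  refine hcop.dvd_of_dvd_mul_left ?_
  have e0 := hrefl 0
  have e1 := hrefl p
  have e2 := hrefl (2 * p)
  have e3 := hrefl (3 * p)
  have key : 2 * (5 * f.eval 0 - 9 * f.eval (p : ℤ) + 5 * f.eval (2 * p : ℤ)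
      - f.eval (3 * p : ℤ))
      = 5 * (f.eval 0 + f.eval (-(p : ℤ) - 0)) - 9 * (f.eval (p : ℤ) + f.eval (-(p : ℤ) - p))
        + 5 * (f.eval (2 * p : ℤ) + f.eval (-(p : ℤ) - 2 * p))
        - (f.eval (3 * p : ℤ) + f.eval (-(p : ℤ) - 3 * p)) := by
    rw [e0, e1, e2, e3]
    ring
  rw [key]
  simp only [hq, sum_range_succ, sum_range_zero, hc]
  refine ⟨c * (5 * (0 + (-1) ^ 6) - 9 * (1 + (-2) ^ 6) + 5 * (2 ^ 6 + (-3) ^ 6)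
      - (3 ^ 6 + (-4) ^ 6))
    + (5 * (-1) ^ 7 * q.eval (-(p : ℤ) - 0)
      - 9 * (q.eval (p : ℤ) + (-2) ^ 7 * q.eval (-(p : ℤ) - p))
      + 5 * (2 ^ 7 * q.eval (2 * p : ℤ) + (-3) ^ 7 * q.eval (-(p : ℤ) - 2 * p))
      - (3 ^ 7 * q.eval (3 * p : ℤ) + (-4) ^ 7 * q.eval (-(p : ℤ) - 3 * p))), ?_⟩
  generalize q.eval (-(p : ℤ) - 0) = a0
  generalize q.eval (-(p : ℤ) - p) = a1
  generalize q.eval (-(p : ℤ) - 2 * p) = a2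
  generalize q.eval (-(p : ℤ) - 3 * p) = a3
  generalize q.eval (2 * p : ℤ) = b2
  generalize q.eval (3 * p : ℤ) = b3
  ring

theorem stmt4 (p : ℕ) (hp : p.Prime) (h : 7 < p) :
    (p : ℤ)^7 ∣ 60 - 54 * (Nat.choose (2*p) p : ℤ) + 20 * (Nat.choose (3*p) p : ℤ)
      - 3 * (Nat.choose (4*p) p : ℤ) := by
  have hcop : IsCoprime ((p : ℤ) ^ 7) ((p - 1).factorial : ℤ) := by
    refine IsCoprime.pow_left (Nat.isCoprime_iff_coprime.mpr ?_)
    exact (hp.coprime_iff_not_dvd).mpr fun hd => by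
      have := (hp.dvd_factorial).mp hd
      omega
  refine hcop.dvd_of_dvd_mul_left ?_
  have c0 := factorial_mul_choose_eq hp.pos 0
  have c1 := factorial_mul_choose_eq hp.pos 1
  have c2 := factorial_mul_choose_eq hp.pos 2
  have c3 := factorial_mul_choose_eq hp.pos 3
  norm_num at c0 c1 c2 c3
  refine (Dvd.dvd.mul_left (prime_pow_seven_dvd_risingProd hp h) 12).trans (dvd_of_eq ?_)
  linear_combination (-60) * c0 + 54 * c1 - 20 * c2 + 3 * c3
end

section
/- For every positive integer m and all integers a > b > 0, m^3 divides 6 * ∑_{d | m} μ(m/d) * C(a*d, b*d). -/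
open Finset

/-- The natural numbers below `n` that are not divisible by `p`. -/
def nonMultiples (p n : ℕ) : Finset ℕ := (range n).filter (fun i => ¬ p ∣ i)

theorem mem_nonMultiples {p n i : ℕ} : i ∈ nonMultiples p n ↔ i < n ∧ ¬ p ∣ i := by
  simp [nonMultiples]

theorem filter_dvd_range_mul {p : ℕ} (hp : 0 < p) (n : ℕ) :
    (range (p * n)).filter (fun i => p ∣ i) = (range n).image (p * ·) := by
  ext i
  simp only [mem_filter, mem_range, mem_image]
  constructor
  · rintro ⟨hi, j, rfl⟩
    exact ⟨j, lt_of_mul_lt_mul_left hi hp.le, rfl⟩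
  · rintro ⟨j, hj, rfl⟩
    exact ⟨Nat.mul_lt_mul_of_pos_left hj hp, dvd_mul_right _ _⟩

theorem factorial_mul_eq {p : ℕ} (hp : 0 < p) (n : ℕ) :
    (p * n).factorial = p ^ n * n.factorial * ∏ i ∈ nonMultiples p (p * n), i := by
  have hfact : ∀ n : ℕ, ∏ i ∈ Icc 1 n, i = n.factorial := fun n => by
    rw [← prod_Ico_id_eq_factorial, Ico_add_one_right_eq_Icc]
  rw [← hfact,
    ← prod_filter_mul_prod_filter_not (Icc 1 (p * n)) (fun i => p ∣ i)]
  congr 1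
  · have h : (Icc 1 (p * n)).filter (fun i => p ∣ i) = (Icc 1 n).image (p * ·) := by
      ext i
      simp only [mem_filter, mem_Icc, mem_image]
      constructor
      · rintro ⟨⟨h1, h2⟩, j, rfl⟩
        exact ⟨j, ⟨Nat.pos_of_mul_pos_left h1, le_of_mul_le_mul_left h2 hp⟩, rfl⟩
      · rintro ⟨j, ⟨h1, h2⟩, rfl⟩
        exact ⟨⟨Nat.mul_pos hp h1, Nat.mul_le_mul_left p h2⟩, dvd_mul_right _ _⟩
    rw [h, prod_image (fun a _ b _ hab => Nat.eq_of_mul_eq_mul_left hp hab), prod_mul_distrib,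
      hfact]
    simp
  · refine prod_congr ?_ fun _ _ => rfl
    ext i
    simp only [mem_filter, mem_Icc, mem_nonMultiples]
    constructor
    · rintro ⟨⟨h1, h2⟩, h⟩
      refine ⟨lt_of_le_of_ne h2 ?_, h⟩
      rintro rfl
      exact h (dvd_mul_right _ _)
    · rintro ⟨h1, h⟩
      refine ⟨⟨Nat.pos_of_ne_zero ?_, h1.le⟩, h⟩
      rintro rfl
      exact h (dvd_zero _)

theorem prod_nonMultiples_add {p : ℕ} (B n : ℕ) {M : Type*} [CommMonoid M] (f : ℕ → M) :
    ∏ i ∈ nonMultiples p (p * B + n), f i =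
      (∏ i ∈ nonMultiples p (p * B), f i) * ∏ i ∈ nonMultiples p n, f (p * B + i) := by
  simp only [nonMultiples, prod_filter]
  rw [prod_range_add]
  congr 1
  refine prod_congr rfl fun i _ => ?_
  simp [(Nat.dvd_add_right (dvd_mul_right p B))]

theorem choose_mul_prod_nonMultiples {p : ℕ} (hp : 0 < p) (B C : ℕ) :
    (p * (B + C)).choose (p * B) * ∏ i ∈ nonMultiples p (p * C), i =
      (B + C).choose B * ∏ i ∈ nonMultiples p (p * C), (p * B + i) := by
  have h1 := Nat.choose_mul_factorial_mul_factorial (Nat.le_add_right (p * B) (p * C))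
  have h2 := Nat.choose_mul_factorial_mul_factorial (Nat.le_add_right B C)
  have h3 := prod_nonMultiples_add (p := p) B (p * C) (fun i : ℕ => i)
  have hB : 0 < (p * B).factorial := Nat.factorial_pos _
  have hC : 0 < p ^ C * C.factorial := Nat.mul_pos (pow_pos hp _) (Nat.factorial_pos _)
  rw [Nat.add_sub_cancel_left] at h1 h2
  rw [← mul_add, factorial_mul_eq hp (B + C), factorial_mul_eq hp C, ← h2, mul_add, h3] at h1
  refine Nat.eq_of_mul_eq_mul_right (Nat.mul_pos hB hC) ?_
  rw [mul_add]
  calc _ = _ := by ring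
    _ = _ := h1
    _ = _ := by rw [factorial_mul_eq hp B]; ring

theorem six_mul_sum_range_sq (n : ℕ) :
    6 * ∑ i ∈ range n, (i : ℤ) ^ 2 = (n - 1) * n * (2 * n - 1) := by
  induction n with
  | zero => simp
  | succ n ih => rw [sum_range_succ, mul_add, ih]; push_cast; ring

theorem dvd_six_mul_sum_sq {p : ℕ} (hp : 0 < p) (n : ℕ) :
    ((p * n : ℕ) : ℤ) ∣ 6 * ∑ i ∈ nonMultiples p (p * n), (i : ℤ) ^ 2 := by
  have h := sum_filter_add_sum_filter_not (range (p * n)) (fun i => p ∣ i) (fun i => (i : ℤ) ^ 2)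
  rw [filter_dvd_range_mul hp,
    sum_image (fun a _ b _ hab => Nat.eq_of_mul_eq_mul_left hp hab)] at h
  push_cast at h
  simp only [mul_pow, ← mul_sum] at h
  have h1 := six_mul_sum_range_sq (p * n)
  have h2 := six_mul_sum_range_sq n
  refine ⟨(p * n - 1) * (2 * (p * n) - 1) - p * (n - 1) * (2 * n - 1), ?_⟩
  push_cast at h1 ⊢
  unfold nonMultiples
  linear_combination 6 * h + h1 - (p : ℤ) ^ 2 * h2

theorem sum_inv_sq_eq_sum_sq {p k : ℕ} (hp : p.Prime) (hk : k ≠ 0) :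
    ∑ i ∈ nonMultiples p (p ^ k), ((i : ZMod (p ^ k))⁻¹) ^ 2 =
      ∑ i ∈ nonMultiples p (p ^ k), (i : ZMod (p ^ k)) ^ 2 := by
  have : NeZero (p ^ k) := ⟨pow_ne_zero _ hp.ne_zero⟩
  have hunit : ∀ i : ℕ, IsUnit (i : ZMod (p ^ k)) ↔ ¬ p ∣ i := fun i => by
    rw [ZMod.isUnit_iff_coprime, Nat.coprime_pow_right_iff (Nat.pos_of_ne_zero hk),
      Nat.coprime_comm, hp.coprime_iff_not_dvd]
  have hinv : ∀ x : ZMod (p ^ k), IsUnit x → IsUnit x⁻¹ := fun x hx =>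
    IsUnit.of_mul_eq_one x (ZMod.inv_mul_of_unit x hx)
  have hinvinv : ∀ x : ZMod (p ^ k), IsUnit x → x⁻¹⁻¹ = x := fun x hx => by
    have h1 := ZMod.inv_mul_of_unit x hx
    have h2 := ZMod.inv_mul_of_unit x⁻¹ (hinv x hx)
    linear_combination x * h2 - x⁻¹⁻¹ * h1
  have hmem : ∀ i ∈ nonMultiples p (p ^ k),
      ((i : ZMod (p ^ k))⁻¹).val ∈ nonMultiples p (p ^ k) := fun i hi => by
    rw [mem_nonMultiples] at hi ⊢
    refine ⟨ZMod.val_lt _, (hunit _).1 ?_⟩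
    rw [ZMod.natCast_zmod_val]
    exact hinv _ ((hunit i).2 hi.2)
  have hleft : ∀ i ∈ nonMultiples p (p ^ k),
      ((((i : ZMod (p ^ k))⁻¹).val : ZMod (p ^ k))⁻¹).val = i := fun i hi => by
    rw [mem_nonMultiples] at hi
    rw [ZMod.natCast_zmod_val, hinvinv _ ((hunit i).2 hi.2), ZMod.val_cast_of_lt hi.1]
  refine sum_nbij' (fun i => ((i : ZMod (p ^ k))⁻¹).val) (fun i => ((i : ZMod (p ^ k))⁻¹).val)
    hmem hmem hleft hleft fun i _ => ?_
  rw [ZMod.natCast_zmod_val]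

theorem sum_nonMultiples_pow_mul {p k : ℕ} (hk : k ≠ 0) (c : ℕ) (g : ZMod (p ^ k) → ZMod (p ^ k)) :
    ∑ i ∈ nonMultiples p (p ^ k * c), g i = c * ∑ i ∈ nonMultiples p (p ^ k), g i := by
  induction c with
  | zero => simp [nonMultiples]
  | succ c ih =>
    have hdvd : p ∣ p ^ k * c := (dvd_pow_self p hk).mul_right c
    rw [mul_add, mul_one]
    push_cast
    rw [add_mul, one_mul, ← ih]
    simp only [nonMultiples, sum_filter]
    rw [sum_range_add]
    congr 1
    refine sum_congr rfl fun i _ => ?_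
    simp [Nat.dvd_add_right hdvd]

theorem dvd_prod_add_sub {N : ℤ} (y : ℤ) (hy : N ^ 2 ∣ y) (s : Finset ℕ) (f h : ℕ → ℤ)
    (hfh : ∀ i ∈ s, N ∣ f i * h i - 1) :
    N ^ 3 ∣ ∏ i ∈ s, (y + f i) - (∏ i ∈ s, f i) * (1 + y * ∑ i ∈ s, h i) := by
  classical
  induction s using Finset.induction_on with
  | empty => simp
  | insert a s ha ih =>
    obtain ⟨u, hu⟩ := ih fun i hi => hfh i (mem_insert_of_mem hi)
    obtain ⟨v, hv⟩ := hfh a (mem_insert_self a s)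
    obtain ⟨w, rfl⟩ := hy
    rw [prod_insert ha, prod_insert ha, sum_insert ha]
    refine ⟨(N ^ 2 * w + f a) * u + (∏ i ∈ s, f i) * N * w ^ 2 * (∑ i ∈ s, h i)
      - w * v * ∏ i ∈ s, f i, ?_⟩
    linear_combination (N ^ 2 * w + f a) * hu - (∏ i ∈ s, f i) * N ^ 2 * w * hv

theorem prod_nonMultiples_reflect {p n : ℕ} (hn : p ∣ n) {M : Type*} [CommMonoid M] (f : ℕ → M) :
    ∏ i ∈ nonMultiples p n, f (n - i) = ∏ i ∈ nonMultiples p n, f i := by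
  have hmem : ∀ i ∈ nonMultiples p n, n - i ∈ nonMultiples p n := fun i hi => by
    rw [mem_nonMultiples] at hi ⊢
    refine ⟨?_, fun h => hi.2 ((Nat.dvd_sub_iff_right hi.1.le hn).1 h)⟩
    have : i ≠ 0 := by
      rintro rfl
      exact hi.2 (dvd_zero _)
    omega
  have hinv : ∀ i ∈ nonMultiples p n, n - (n - i) = i := fun i hi =>
    Nat.sub_sub_self (mem_nonMultiples.1 hi).1.le
  exact prod_nbij' (n - ·) (n - ·) hmem hmem hinv hinv fun i _ => rfl

theorem prod_add_sq {p n : ℕ} (hn : p ∣ n) (x : ℤ) :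
    (∏ i ∈ nonMultiples p n, (x + i)) ^ 2 =
      ∏ i ∈ nonMultiples p n, (x * (x + n) + i * (n - i)) := by
  rw [sq]
  nth_rewrite 2 [← prod_nonMultiples_reflect hn]
  rw [← prod_mul_distrib]
  refine prod_congr rfl fun i hi => ?_
  rw [Nat.cast_sub (mem_nonMultiples.1 hi).1.le]
  ring

/-- The product of the `p ^ k * b + i` over all `i < p ^ k * c` prime to `p` has the same square,
up to a factor `3`, as for `b = 0`, modulo `p ^ (3 * k)`. -/
theorem dvd_three_mul_sq_sub_sq {p k : ℕ} (hp : p.Prime) (hk : k ≠ 0) (b c : ℕ) :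
    ((p ^ k : ℕ) : ℤ) ^ 3 ∣
      3 * ((∏ i ∈ nonMultiples p (p ^ k * c), (((p ^ k * b : ℕ) : ℤ) + i)) ^ 2
        - (∏ i ∈ nonMultiples p (p ^ k * c), (i : ℤ)) ^ 2) := by
  have hdvd : p ∣ p ^ k * c := (dvd_pow_self p hk).mul_right c
  have h0 := prod_add_sq hdvd 0
  simp only [zero_mul, zero_add] at h0
  rw [prod_add_sq hdvd]
  have : NeZero (p ^ k) := ⟨pow_ne_zero _ hp.ne_zero⟩
  set N := p ^ k with hN
  set s := nonMultiples p (N * c)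
  set h : ℕ → ℤ := fun i => -(((i : ZMod N)⁻¹).val : ℤ) ^ 2 with hh
  set f : ℕ → ℤ := fun i => (i : ℤ) * ((N * c : ℕ) - i) with hf
  have hNc : ((N : ℕ) : ZMod N) = 0 := ZMod.natCast_self N
  have hfh : ∀ i ∈ s, (N : ℤ) ∣ f i * h i - 1 := fun i hi => by
    rw [← ZMod.intCast_zmod_eq_zero_iff_dvd]
    have hu : (i : ZMod N) * (i : ZMod N)⁻¹ = 1 := by
      refine ZMod.coe_mul_inv_eq_one i ?_
      rw [hN, Nat.coprime_pow_right_iff (Nat.pos_of_ne_zero hk),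
        Nat.coprime_comm, hp.coprime_iff_not_dvd]
      exact (mem_nonMultiples.1 hi).2
    simp only [hf, hh]
    push_cast
    rw [ZMod.natCast_zmod_val, hNc]
    linear_combination ((i : ZMod N) * (i : ZMod N)⁻¹ + 1) * hu
  have hT : (N : ℤ) ∣ 6 * ∑ i ∈ nonMultiples p N, (i : ℤ) ^ 2 := by
    obtain ⟨l, rfl⟩ := Nat.exists_eq_succ_of_ne_zero hk
    rw [hN, pow_succ']
    exact dvd_six_mul_sum_sq hp.pos _
  have hS : ((∑ i ∈ s, h i : ℤ) : ZMod N) =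
      -(c * ∑ i ∈ nonMultiples p N, (i : ZMod N) ^ 2) := by
    rw [← sum_inv_sq_eq_sum_sq hp hk, ← sum_nonMultiples_pow_mul hk c (fun x => x⁻¹ ^ 2),
      ← sum_neg_distrib]
    push_cast
    refine sum_congr rfl fun i _ => ?_
    simp only [hh]
    push_cast
    rw [ZMod.natCast_zmod_val]
  have hE : (N : ℤ) ∣ 3 * (b * (b + c)) * ∑ i ∈ s, h i := by
    obtain ⟨e, he⟩ : 2 ∣ b * (b + c) * c := by
      rcases Nat.even_or_odd b with hb | hb
      · exact (hb.two_dvd.mul_right _).mul_right _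
      · rcases Nat.even_or_odd c with hc | hc
        · exact hc.two_dvd.mul_left _
        · exact ((hb.add_odd hc).two_dvd.mul_left _).mul_right _
    rw [← ZMod.intCast_zmod_eq_zero_iff_dvd] at hT ⊢
    push_cast at hT hS ⊢
    rw [hS]
    have he' : (b : ZMod N) * (b + c) * c = 2 * e := by
      exact_mod_cast congrArg (Nat.cast : ℕ → ZMod N) he
    linear_combination -(e : ZMod N) * hT - 3 * (∑ i ∈ nonMultiples p N, (i : ZMod N) ^ 2) * he'
  have hy : ((N * b : ℕ) : ℤ) * ((N * b : ℕ) + (N * c : ℕ)) = (N : ℤ) ^ 2 * (b * (b + c)) := by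
    push_cast; ring
  rw [hy]
  obtain ⟨u, hu⟩ := dvd_prod_add_sub _
    (dvd_mul_right ((N : ℤ) ^ 2) (b * (b + c))) s f h hfh
  obtain ⟨v, hv⟩ := hE
  refine ⟨3 * u + (∏ i ∈ s, f i) * v, ?_⟩
  linear_combination 3 * hu - 3 * h0 + (∏ i ∈ s, f i) * (N : ℤ) ^ 2 * hv

theorem isCoprime_prod_nonMultiples {p : ℕ} (hp : p.Prime) (n : ℕ) :
    IsCoprime (p : ℤ) (∏ i ∈ nonMultiples p n, (i : ℤ)) := by
  refine IsCoprime.prod_right fun i hi => ?_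
  rw [Nat.isCoprime_iff_coprime, hp.coprime_iff_not_dvd]
  exact (mem_nonMultiples.1 hi).2

theorem four_dvd_choose_two_mul_sub (A B : ℕ) :
    (4 : ℤ) ∣ (2 * A).choose (2 * B) - A.choose B := by
  induction A generalizing B with
  | zero => cases B <;> simp [mul_add]
  | succ A ih =>
    cases B with
    | zero => simp
    | succ B =>
      have h1 : (2 : ℤ) ∣ (2 * A).choose (2 * B + 1) := by
        have h := Nat.add_one_mul_choose_eq (2 * A - 1) (2 * B)
        rcases Nat.eq_zero_or_pos A with rfl | hA
        · simp
        rw [Nat.sub_add_cancel (by omega)] at h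
        have h2 : 2 ∣ (2 * A).choose (2 * B + 1) * (2 * B + 1) := by
          rw [← h, mul_assoc]
          exact dvd_mul_right _ _
        exact_mod_cast (Nat.Coprime.dvd_of_dvd_mul_right (by simp) h2)
      have h2 : (2 * (A + 1)).choose (2 * (B + 1)) =
          (2 * A).choose (2 * B) + 2 * (2 * A).choose (2 * B + 1)
            + (2 * A).choose (2 * (B + 1)) := by
        rw [mul_add, mul_add, mul_one, Nat.choose_succ_succ' (2 * A + 1),
          Nat.choose_succ_succ' (2 * A), Nat.choose_succ_succ' (2 * A)]
        ring
      rw [h2, Nat.choose_succ_succ']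
      push_cast
      have := ih B
      have := ih (B + 1)
      omega

/-- A form of the Jacobsthal–Kazandzidis congruence valid for all primes. -/
theorem pow_dvd_six_mul_choose_sub {p : ℕ} (hp : p.Prime) (l b c : ℕ) :
    ((p ^ (l + 1) : ℕ) : ℤ) ^ 3 ∣ 6 * (((p ^ (l + 1) * (b + c)).choose (p ^ (l + 1) * b) : ℤ)
      - (p ^ l * (b + c)).choose (p ^ l * b)) := by
  have h1 := dvd_three_mul_sq_sub_sq hp (Nat.succ_ne_zero l) b c
  have h2 := choose_mul_prod_nonMultiples hp.pos (p ^ l * b) (p ^ l * c)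
  have hcop := isCoprime_prod_nonMultiples hp (p ^ (l + 1) * c)
  have hQP : ((p ^ (l + 1) : ℕ) : ℤ) ∣
      ∏ i ∈ nonMultiples p (p ^ (l + 1) * c), (((p ^ (l + 1) * b : ℕ) : ℤ) + i) -
        ∏ i ∈ nonMultiples p (p ^ (l + 1) * c), (i : ℤ) := by
    rw [← ZMod.intCast_zmod_eq_zero_iff_dvd]
    have h0 : (p : ZMod (p ^ (l + 1))) ^ (l + 1) = 0 := by
      exact_mod_cast ZMod.natCast_self (p ^ (l + 1))
    simp [h0]
  rw [← mul_add, ← mul_assoc, ← mul_assoc, ← mul_assoc, ← pow_succ'] at h2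
  have h2' : ((p ^ (l + 1) * (b + c)).choose (p ^ (l + 1) * b) : ℤ) *
      ∏ i ∈ nonMultiples p (p ^ (l + 1) * c), (i : ℤ) =
      (p ^ l * (b + c)).choose (p ^ l * b) *
      ∏ i ∈ nonMultiples p (p ^ (l + 1) * c), (((p ^ (l + 1) * b : ℕ) : ℤ) + i) := by
    have := congrArg (Nat.cast : ℕ → ℤ) h2
    push_cast at this ⊢
    exact this
  set P := ∏ i ∈ nonMultiples p (p ^ (l + 1) * c), (i : ℤ)
  set Q := ∏ i ∈ nonMultiples p (p ^ (l + 1) * c), (((p ^ (l + 1) * b : ℕ) : ℤ) + i)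
  have hpow : ∀ z : ℤ, IsCoprime (p : ℤ) z → IsCoprime (((p ^ (l + 1) : ℕ) : ℤ) ^ 3) z := by
    intro z hz
    push_cast
    exact hz.pow_left.pow_left
  suffices hQ : p = 2 ∧ l = 0 ∨ ((p ^ (l + 1) : ℕ) : ℤ) ^ 3 ∣ 6 * (Q - P) by
    rcases hQ with ⟨rfl, rfl⟩ | hQ
    · have := four_dvd_choose_two_mul_sub (b + c) b
      norm_num
      omega
    · refine (hpow P hcop).dvd_of_dvd_mul_right ?_
      have : 6 * (((p ^ (l + 1) * (b + c)).choose (p ^ (l + 1) * b) : ℤ)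
          - (p ^ l * (b + c)).choose (p ^ l * b)) * P =
          (p ^ l * (b + c)).choose (p ^ l * b) * (6 * (Q - P)) := by
        linear_combination 6 * h2'
      rw [this]
      exact hQ.mul_left _
  obtain ⟨t, ht⟩ := hQP
  rcases hp.eq_two_or_odd' with rfl | hodd
  · rcases Nat.eq_zero_or_pos l with rfl | hl
    · exact Or.inl ⟨rfl, rfl⟩
    right
    obtain ⟨j, rfl⟩ : ∃ j, l = j + 1 := ⟨l - 1, by omega⟩
    have hw : IsCoprime ((2 : ℕ) : ℤ) (P + 2 * (2 ^ j * t)) := by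
      exact_mod_cast (IsCoprime.add_mul_left_right_iff (y := P) (z := 2 ^ j * t)).2 hcop
    refine (hpow _ hw).dvd_of_dvd_mul_right ?_
    have hsum : Q + P = 2 * (P + 2 * (2 ^ j * t)) := by
      push_cast at ht
      linear_combination ht
    have : 6 * (Q - P) * (P + 2 * (2 ^ j * t)) = 3 * (Q ^ 2 - P ^ 2) := by
      linear_combination (-3) * (Q - P) * hsum
    rw [this]
    exact h1
  · right
    have hw : IsCoprime (p : ℤ) (Q + P) := by
      have h2p : IsCoprime (p : ℤ) 2 := by
        have := Nat.isCoprime_iff_coprime.2 (Nat.coprime_two_right.2 hodd)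
        exact_mod_cast this
      have : Q + P = 2 * P + p * (p ^ l * t) := by
        push_cast at ht
        linear_combination ht
      rw [this, IsCoprime.add_mul_left_right_iff]
      exact h2p.mul_right hcop
    refine (hpow _ hw).dvd_of_dvd_mul_right ?_
    have : 6 * (Q - P) * (Q + P) = 2 * (3 * (Q ^ 2 - P ^ 2)) := by ring
    rw [this]
    exact h1.mul_left _

theorem sum_divisors_mul_of_coprime {m n : ℕ} (hmn : m.Coprime n) {M : Type*} [AddCommMonoid M]
    (f : ℕ → M) :
    ∑ d ∈ (m * n).divisors, f d = ∑ e ∈ n.divisors, ∑ d ∈ m.divisors, f (d * e) := by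
  rw [hmn.divisors_mul, sum_map, ← sum_product_right _ _ (fun x => f (x.1 * x.2))]
  exact sum_attach (m.divisors ×ˢ n.divisors) (fun x => f (x.1 * x.2))

open ArithmeticFunction in
theorem sum_divisors_prime_pow_succ_moebius_mul {p : ℕ} (hp : p.Prime) (l : ℕ) (f : ℕ → ℤ) :
    ∑ d ∈ (p ^ (l + 1)).divisors, moebius (p ^ (l + 1) / d) * f d =
      f (p ^ (l + 1)) - f (p ^ l) := by
  rw [Nat.sum_divisors_prime_pow hp, sum_range_succ, sum_range_succ, sum_eq_zero]
  · rw [Nat.div_self (pow_pos hp.pos _), pow_succ, Nat.mul_div_cancel_left _ (pow_pos hp.pos _),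
      moebius_apply_prime hp, moebius_apply_one]
    ring
  · intro i hi
    rw [mem_range] at hi
    rw [Nat.pow_div (by omega) hp.pos, moebius_apply_prime_pow hp (by omega),
      if_neg (by omega), zero_mul]

open ArithmeticFunction in
theorem sum_moebius_mul_eq {p n : ℕ} (hp : p.Prime) (hn : ¬ p ∣ n) (l : ℕ) (f : ℕ → ℤ) :
    ∑ d ∈ (p ^ (l + 1) * n).divisors, moebius (p ^ (l + 1) * n / d) * f d =
      ∑ e ∈ n.divisors, moebius (n / e) * (f (p ^ (l + 1) * e) - f (p ^ l * e)) := by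
  have hcop : (p ^ (l + 1)).Coprime n := (hp.coprime_iff_not_dvd.2 hn).pow_left _
  rw [sum_divisors_mul_of_coprime hcop]
  refine sum_congr rfl fun e he => ?_
  rw [← sum_divisors_prime_pow_succ_moebius_mul hp l (fun d => f (d * e)), mul_sum]
  refine sum_congr rfl fun d hd => ?_
  have hd' := Nat.dvd_of_mem_divisors hd
  have he' := Nat.dvd_of_mem_divisors he
  rw [← Nat.div_mul_div_comm hd' he', isMultiplicative_moebius.map_mul_of_coprime
    (hcop.of_dvd (Nat.div_dvd_of_dvd hd') (Nat.div_dvd_of_dvd he'))]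
  ring

open ArithmeticFunction in
theorem stmt14 (m a b : ℕ) (hm : 0 < m) (hb : 0 < b) (hab : b < a) :
    (m : ℤ)^3 ∣ 6 * ∑ d ∈ m.divisors, moebius (m / d) * (Nat.choose (a*d) (b*d) : ℤ) := by
  rw [← Int.natCast_pow, Int.natCast_dvd, Nat.dvd_iff_prime_pow_dvd_dvd]
  intro p j hp hj
  obtain ⟨k, n, hn, rfl⟩ := Nat.exists_eq_pow_mul_and_not_dvd hm.ne' p hp.ne_one
  rw [mul_pow] at hj
  have hj' := (((hp.coprime_iff_not_dvd.2 hn).pow_right 3).pow_left j).dvd_of_dvd_mul_right hj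
  refine hj'.trans ?_
  rw [← Int.natCast_dvd]
  cases k with
  | zero => simp
  | succ l =>
    rw [sum_moebius_mul_eq hp hn l (fun d => ((a * d).choose (b * d) : ℤ)), mul_sum]
    refine dvd_sum fun e _ => ?_
    obtain ⟨c, rfl⟩ := Nat.exists_eq_add_of_le hab.le
    have h := pow_dvd_six_mul_choose_sub hp l (b * e) (c * e)
    have h1 : ∀ i, (b + c) * (p ^ i * e) = p ^ i * (b * e + c * e) := fun i => by ring
    have h2 : ∀ i, b * (p ^ i * e) = p ^ i * (b * e) := fun i => by ring
    rw [h1, h1, h2, h2, mul_left_comm, Int.natCast_pow]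
    exact h.mul_left _
end

section
/- For every positive integer m and all integers a > b > 0, m^3 divides 12 * ∑_{d | m} (-1)^{m+d} * μ(m/d) * C(a*d, b*d). -/
/-- The product of `x + i` over the residues `i < n` that are not divisible by `p`. -/
def primeToProd (p n : ℕ) (x : ℤ) : ℤ :=
  ∏ i ∈ (Finset.range n).filter (fun i => ¬ p ∣ i), (x + i)

theorem factorial_eq_primeToProd (p n : ℕ) :
    (n.factorial : ℤ) = primeToProd p (n + 1) 0 * p ^ (n / p) * ((n / p).factorial : ℤ) := by
  unfold primeToProd
  induction n with
  | zero =>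
    simp [Finset.prod_filter]
  | succ n ih =>
    rw [Finset.prod_filter] at *
    rw [Finset.prod_range_succ, Nat.factorial_succ, Nat.cast_mul, ih, Nat.succ_div]
    by_cases h : p ∣ n + 1
    · have h2 : n + 1 = p * (n / p + 1) := by
        rw [← Nat.succ_div_of_dvd h, Nat.mul_div_cancel' h]
      have h3 : ((n + 1 : ℕ) : ℤ) = p * ((n / p + 1 : ℕ) : ℤ) := by exact_mod_cast h2
      simp only [h, not_true_eq_false, if_true, if_false, Nat.factorial_succ, pow_succ, h3,
        Nat.cast_mul]
      ring
    · simp only [h, not_false_eq_true, if_true, if_false, add_zero]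
      ring

theorem primeToProd_succ_mul (p N : ℕ) (x : ℤ) :
    primeToProd p (p * N + 1) x = primeToProd p (p * N) x := by
  simp [primeToProd, Finset.prod_filter, Finset.prod_range_succ]

theorem factorial_mul_eq_primeToProd (p : ℕ) (hp : 0 < p) (N : ℕ) :
    ((p * N).factorial : ℤ) = primeToProd p (p * N) 0 * p ^ N * (N.factorial : ℤ) := by
  rw [factorial_eq_primeToProd p, primeToProd_succ_mul, Nat.mul_div_cancel_left _ hp]

theorem choose_mul_primeToProd (p : ℕ) (hp : 0 < p) (B C : ℕ) :
    (((p * (B + C)).choose (p * B) : ℕ) : ℤ) *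
        (primeToProd p (p * B) 0 * primeToProd p (p * C) 0) =
      ((B + C).choose B : ℕ) * primeToProd p (p * (B + C)) 0 := by
  have h1 : (((p * (B + C)).choose (p * B) : ℕ) : ℤ) * (p * B).factorial * (p * C).factorial
      = (p * (B + C)).factorial := by
    rw [mul_add, Nat.choose_symm_add]
    exact_mod_cast Nat.add_choose_mul_factorial_mul_factorial (p * B) (p * C)
  have h2 : (((B + C).choose B : ℕ) : ℤ) * B.factorial * C.factorial = (B + C).factorial := by
    rw [Nat.choose_symm_add]
    exact_mod_cast Nat.add_choose_mul_factorial_mul_factorial B C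
  rw [factorial_mul_eq_primeToProd p hp, factorial_mul_eq_primeToProd p hp,
    factorial_mul_eq_primeToProd p hp, ← h2] at h1
  have hne : (p : ℤ) ^ (B + C) * (B.factorial * C.factorial) ≠ 0 := by positivity
  apply mul_right_cancel₀ hne
  rw [pow_add] at *
  linear_combination h1

theorem primeToProd_mul (p q : ℕ) (hpq : p ∣ q) (b : ℕ) :
    primeToProd p (q * b) 0 = ∏ j ∈ Finset.range b, primeToProd p q (q * j) := by
  induction b with
  | zero => simp [primeToProd]
  | succ b ih =>
    rw [Finset.prod_range_succ, ← ih]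
    simp only [primeToProd, Finset.prod_filter]
    rw [mul_add, mul_one, Finset.prod_range_add]
    congr 1
    apply Finset.prod_congr rfl
    intro i _
    simp [Nat.dvd_add_right (hpq.mul_right b)]

theorem isCoprime_primeToProd (p : ℕ) (hp : p.Prime) (n : ℕ) (x : ℤ) (hx : (p : ℤ) ∣ x) :
    IsCoprime (p : ℤ) (primeToProd p n x) := by
  refine IsCoprime.prod_right fun i hi => ?_
  rw [(Nat.prime_iff_prime_int.mp hp).coprime_iff_not_dvd, dvd_add_right hx,
    Int.natCast_dvd_natCast]
  exact (Finset.mem_filter.mp hi).2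

theorem primeToProd_mul_self (p q : ℕ) (hpq : p ∣ q) (x : ℤ) :
    primeToProd p q x * primeToProd p q x =
      ∏ i ∈ (Finset.range q).filter (fun i => ¬ p ∣ i), (x * (x + q) + i * (q - i)) := by
  have h : primeToProd p q x =
      ∏ i ∈ (Finset.range q).filter (fun i => ¬ p ∣ i), (x + (q - i)) := by
    have hmem : ∀ i ∈ (Finset.range q).filter (fun i => ¬ p ∣ i),
        q - i ∈ (Finset.range q).filter (fun i => ¬ p ∣ i) := by
      intro i hi
      simp only [Finset.mem_filter, Finset.mem_range] at hi ⊢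
      have h0 : i ≠ 0 := by rintro rfl; simp at hi
      refine ⟨by omega, fun h => hi.2 ?_⟩
      exact (Nat.dvd_sub_iff_right hi.1.le hpq).mp h
    unfold primeToProd
    refine Finset.prod_nbij' (fun i => q - i) (fun i => q - i) hmem hmem ?_ ?_ ?_
    all_goals
      intro i hi
      simp only [Finset.mem_filter, Finset.mem_range] at hi
    · omega
    · omega
    · rw [Nat.cast_sub hi.1.le]; ring
  conv_lhs => rw [h]
  nth_rewrite 1 [← h]
  unfold primeToProd
  rw [← Finset.prod_mul_distrib]
  refine Finset.prod_congr rfl fun i _ => by ring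

theorem six_mul_sum_sq_not_dvd (p n : ℕ) :
    6 * ∑ i ∈ (Finset.range (n + 1)).filter (fun i => ¬ p ∣ i), (i : ℤ) ^ 2 =
      n * (n + 1) * (2 * n + 1) -
        p ^ 2 * ((n / p : ℕ) * ((n / p : ℕ) + 1) * (2 * (n / p : ℕ) + 1)) := by
  induction n with
  | zero => simp [Finset.sum_filter]
  | succ n ih =>
    rw [Finset.sum_filter] at *
    rw [Finset.sum_range_succ, mul_add, ih, Nat.succ_div]
    by_cases h : p ∣ n + 1
    · have h2 : n + 1 = p * (n / p + 1) := by
        rw [← Nat.succ_div_of_dvd h, Nat.mul_div_cancel' h]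
      have h3 : (n : ℤ) + 1 = p * ((n / p : ℕ) + 1) := by exact_mod_cast h2
      simp only [h, not_true_eq_false, if_true, if_false]
      push_cast at h3 ⊢
      linear_combination (-6 * (n + 1 + p * ((n : ℤ) / p + 1))) * h3
    · simp only [h, not_false_eq_true, if_true, if_false, add_zero]
      push_cast
      ring

theorem dvd_six_mul_sum_sq_not_dvd (p N : ℕ) (hp : 0 < p) :
    ((p * N : ℕ) : ℤ) ∣
      6 * ∑ i ∈ (Finset.range (p * N)).filter (fun i => ¬ p ∣ i), (i : ℤ) ^ 2 := by
  have h := six_mul_sum_sq_not_dvd p (p * N)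
  rw [Finset.sum_filter, Finset.sum_range_succ] at h
  simp only [dvd_mul_right, not_true_eq_false, if_false, add_zero] at h
  rw [← Finset.sum_filter] at h
  rw [h, Nat.mul_div_cancel_left _ hp]
  push_cast
  refine dvd_sub ⟨(p * N + 1) * (2 * (p * N) + 1), by ring⟩ ⟨p * ((N + 1) * (2 * N + 1)), by ring⟩

theorem sum_sq_inv_val (p k : ℕ) (hp : p.Prime) :
    ∑ i ∈ (Finset.range (p ^ (k + 1))).filter (fun i => ¬ p ∣ i),
        ((((i : ZMod (p ^ (k + 1)))⁻¹).val : ℕ) : ℤ) ^ 2 =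
      ∑ i ∈ (Finset.range (p ^ (k + 1))).filter (fun i => ¬ p ∣ i), (i : ℤ) ^ 2 := by
  have : NeZero (p ^ (k + 1)) := ⟨pow_ne_zero _ hp.ne_zero⟩
  have hunit : ∀ i : ℕ, ¬ p ∣ i ↔ IsUnit (i : ZMod (p ^ (k + 1))) := by
    intro i
    rw [ZMod.isUnit_iff_coprime, Nat.coprime_pow_right_iff (Nat.succ_pos k), Nat.coprime_comm,
      hp.coprime_iff_not_dvd]
  have hmem : ∀ i ∈ (Finset.range (p ^ (k + 1))).filter (fun i => ¬ p ∣ i),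
      ((i : ZMod (p ^ (k + 1)))⁻¹).val ∈
        (Finset.range (p ^ (k + 1))).filter (fun i => ¬ p ∣ i) := by
    intro i hi
    simp only [Finset.mem_filter, Finset.mem_range] at hi ⊢
    refine ⟨ZMod.val_lt _, ?_⟩
    rw [hunit, ZMod.natCast_zmod_val]
    exact IsUnit.of_mul_eq_one _ (ZMod.inv_mul_of_unit _ ((hunit i).mp hi.2))
  have hinv : ∀ i ∈ (Finset.range (p ^ (k + 1))).filter (fun i => ¬ p ∣ i),
      (((((i : ZMod (p ^ (k + 1)))⁻¹).val : ℕ) : ZMod (p ^ (k + 1)))⁻¹).val = i := by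
    intro i hi
    simp only [Finset.mem_filter, Finset.mem_range] at hi
    have h1 := ZMod.inv_mul_of_unit _ ((hunit i).mp hi.2)
    rw [ZMod.natCast_zmod_val, ZMod.inv_eq_of_mul_eq_one _ _ _ h1, ZMod.val_natCast,
      Nat.mod_eq_of_lt hi.1]
  exact Finset.sum_nbij' (fun i => ((i : ZMod (p ^ (k + 1)))⁻¹).val)
    (fun i => ((i : ZMod (p ^ (k + 1)))⁻¹).val) hmem hmem hinv hinv (fun _ _ => rfl)

theorem prod_one_sub_mul_modEq {ι : Type*} (s : Finset ι) (f : ι → ℤ) (y n : ℤ)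
    (hy : n ∣ y ^ 2) : ∏ i ∈ s, (1 - y * f i) ≡ 1 - y * ∑ i ∈ s, f i [ZMOD n] := by
  classical
  induction s using Finset.induction_on with
  | empty => simp [Int.ModEq.refl]
  | insert a s ha ih =>
    rw [Finset.prod_insert ha, Finset.sum_insert ha]
    refine (ih.mul_left _).trans ?_
    rw [Int.modEq_iff_dvd]
    refine (hy.mul_right (-(f a * ∑ i ∈ s, f i))).trans (dvd_of_eq ?_)
    ring

theorem twelve_mul_primeToProd_modEq (p k : ℕ) (hp : p.Prime) (hq : p ^ (k + 1) ≠ 2) (t : ℤ) :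
    12 * primeToProd p (p ^ (k + 1)) ((p ^ (k + 1) : ℕ) * t) ≡
      12 * primeToProd p (p ^ (k + 1)) 0 [ZMOD ((p ^ (k + 1) : ℕ) : ℤ) ^ 3] := by
  have hpq : p ∣ p ^ (k + 1) := dvd_pow_self p (Nat.succ_ne_zero k)
  have hsum := dvd_six_mul_sum_sq_not_dvd p (p ^ k) hp.pos
  rw [← pow_succ', ← sum_sq_inv_val p k hp] at hsum
  have hcop : IsCoprime (p : ℤ) (primeToProd p (p ^ (k + 1)) 0) :=
    isCoprime_primeToProd p hp _ 0 (dvd_zero _)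
  have hsq := primeToProd_mul_self p (p ^ (k + 1)) hpq
  have hinv : ∀ i ∈ (Finset.range (p ^ (k + 1))).filter (fun i => ¬ p ∣ i),
      ((p ^ (k + 1) : ℕ) : ℤ) ∣
        1 - (i : ℤ) ^ 2 * ((((i : ZMod (p ^ (k + 1)))⁻¹).val : ℕ) : ℤ) ^ 2 := by
    intro i hi
    have : NeZero (p ^ (k + 1)) := ⟨pow_ne_zero _ hp.ne_zero⟩
    have hu : IsUnit (i : ZMod (p ^ (k + 1))) := by
      rw [ZMod.isUnit_iff_coprime, Nat.coprime_pow_right_iff (Nat.succ_pos k), Nat.coprime_comm,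
        hp.coprime_iff_not_dvd]
      exact (Finset.mem_filter.mp hi).2
    rw [← ZMod.intCast_zmod_eq_zero_iff_dvd]
    push_cast
    rw [ZMod.natCast_zmod_val, ← mul_pow, ZMod.mul_inv_of_unit _ hu]
    simp
  have hd : ((p ^ (k + 1) : ℕ) : ℤ) ∣ primeToProd p (p ^ (k + 1)) ((p ^ (k + 1) : ℕ) * t) -
      primeToProd p (p ^ (k + 1)) 0 := by
    rw [← Int.modEq_iff_dvd]
    refine Int.ModEq.prod fun i _ => ?_
    rw [Int.modEq_iff_dvd]
    exact ⟨t, by ring⟩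
  have hpZ := Nat.prime_iff_prime_int.mp hp
  have hpqZ : (p : ℤ) ∣ ((p ^ (k + 1) : ℕ) : ℤ) := by exact_mod_cast hpq
  have hp2 : (p = 2 ∧ 4 ∣ p ^ (k + 1)) ∨ ¬ (p : ℤ) ∣ 2 := by
    by_cases h : p = 2
    · subst h
      left
      obtain ⟨l, rfl⟩ : ∃ l, k = l + 1 := Nat.exists_eq_succ_of_ne_zero (by rintro rfl; simp at hq)
      exact ⟨rfl, 2 ^ l, by ring⟩
    · right
      intro h2
      exact h ((Nat.prime_dvd_prime_iff_eq hp Nat.prime_two).mp (by exact_mod_cast h2))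
  have hqpow : ((p ^ (k + 1) : ℕ) : ℤ) ^ 3 = (p : ℤ) ^ ((k + 1) * 3) := by
    push_cast
    rw [← pow_mul]
  have hcopq : ∀ z : ℤ, ¬ (p : ℤ) ∣ z → IsCoprime (((p ^ (k + 1) : ℕ) : ℤ) ^ 3) z := by
    intro z hz
    rw [hqpow]
    exact IsCoprime.pow_left (hpZ.coprime_iff_not_dvd.mpr hz)
  have hp0 : ¬ (p : ℤ) ∣ primeToProd p (p ^ (k + 1)) 0 := hpZ.coprime_iff_not_dvd.mp hcop
  generalize primeToProd p (p ^ (k + 1)) = F at *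
  generalize (Finset.range (p ^ (k + 1))).filter (fun i => ¬ p ∣ i) = s at *
  generalize p ^ (k + 1) = q at *
  have hF : F (q * t) * F (q * t) ≡ F 0 * F 0 *
      (1 - q * t * (q * t + q) * ∑ i ∈ s, (((i : ZMod q)⁻¹.val : ℕ) : ℤ) ^ 2)
      [ZMOD (q : ℤ) ^ 3] := by
    rw [hsq, hsq]
    refine Int.ModEq.trans (b := ∏ i ∈ s, ((0 * (0 + (q : ℤ)) + i * (q - i)) *
      (1 - q * t * (q * t + q) * (((i : ZMod q)⁻¹.val : ℕ) : ℤ) ^ 2))) ?_ ?_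
    · refine Int.ModEq.prod fun i hi => ?_
      rw [Int.modEq_iff_dvd]
      obtain ⟨c, hc⟩ := hinv i hi
      refine ⟨-(t * (t + 1) * (c + i * (((i : ZMod q)⁻¹.val : ℕ) : ℤ) ^ 2)), ?_⟩
      linear_combination (-q ^ 2 * t * (t + 1) : ℤ) * hc
    · rw [Finset.prod_mul_distrib]
      exact (prod_one_sub_mul_modEq s _ _ _ ⟨q * (t * (t + 1)) ^ 2, by ring⟩).mul_left _
  generalize ∑ i ∈ s, (((i : ZMod q)⁻¹.val : ℕ) : ℤ) ^ 2 = σ at *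
  have hmul : (q : ℤ) ^ 3 ∣ 6 * (F (q * t) - F 0) * (F (q * t) + F 0) := by
    obtain ⟨c, hc⟩ := hF.dvd
    obtain ⟨e, he⟩ := hsum
    refine ⟨-6 * c - F 0 * F 0 * (t * (t + 1)) * e, ?_⟩
    linear_combination (-6) * hc - F 0 * F 0 * (q ^ 2 * t * (t + 1)) * he
  apply Int.ModEq.symm
  rw [Int.modEq_iff_dvd]
  rcases hp2 with ⟨rfl, w, rfl⟩ | h2
  · obtain ⟨d, hd⟩ := hd
    have hz : ¬ ((2 : ℕ) : ℤ) ∣ F 0 + 2 * w * d := by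
      push_cast at hp0 ⊢
      rwa [mul_assoc, dvd_add_left (dvd_mul_right _ _)]
    refine (hcopq _ hz).dvd_of_dvd_mul_right (hmul.trans (dvd_of_eq ?_))
    push_cast at hd ⊢
    linear_combination (6 * (F (4 * w * t) - F 0)) * hd
  · have hz : ¬ (p : ℤ) ∣ F (q * t) + F 0 := by
      intro h
      have h3 : (p : ℤ) ∣ 2 * F 0 := by
        have := dvd_sub h (hpqZ.trans hd)
        rwa [show F (q * t) + F 0 - (F (q * t) - F 0) = 2 * F 0 by ring] at this
      exact (hpZ.dvd_or_dvd h3).elim h2 hp0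
    have := (hcopq _ hz).dvd_of_dvd_mul_right hmul
    exact (this.mul_left 2).trans (dvd_of_eq (by ring))

theorem primeToProd_self_mul_modEq (p k : ℕ) (hp : p.Prime) (hq : p ^ (k + 1) ≠ 2) (b : ℕ) :
    12 * primeToProd p (p ^ (k + 1) * b) 0 ≡
      12 * primeToProd p (p ^ (k + 1)) 0 ^ b [ZMOD ((p ^ (k + 1) : ℕ) : ℤ) ^ 3] := by
  rw [primeToProd_mul p _ (dvd_pow_self p (Nat.succ_ne_zero k))]
  induction b with
  | zero => simp [Int.ModEq.refl]
  | succ b ih =>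
    rw [Finset.prod_range_succ, pow_succ _ b, ← mul_assoc, ← mul_assoc]
    refine (ih.mul_right _).trans ?_
    have h := (twelve_mul_primeToProd_modEq p k hp hq b).mul_left
      (primeToProd p (p ^ (k + 1)) 0 ^ b)
    convert h using 1 <;> ring

theorem twelve_mul_choose_modEq (p k : ℕ) (hp : p.Prime) (hq : p ^ (k + 1) ≠ 2) (b c : ℕ) :
    12 * ((p ^ (k + 1) * (b + c)).choose (p ^ (k + 1) * b) : ℤ) ≡
      12 * ((p ^ k * (b + c)).choose (p ^ k * b) : ℤ) [ZMOD ((p ^ (k + 1) : ℕ) : ℤ) ^ 3] := by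
  have h := choose_mul_primeToProd p hp.pos (p ^ k * b) (p ^ k * c)
  simp only [← mul_add, ← mul_assoc p, ← pow_succ'] at h
  have hb := primeToProd_self_mul_modEq p k hp hq b
  have hc := primeToProd_self_mul_modEq p k hp hq c
  have ha := primeToProd_self_mul_modEq p k hp hq (b + c)
  have hcop : IsCoprime (((p ^ (k + 1) : ℕ) : ℤ) ^ 3)
      (primeToProd p (p ^ (k + 1)) 0 ^ (b + c)) := by
    push_cast
    exact (isCoprime_primeToProd p hp _ 0 (dvd_zero _)).pow_left.pow_left.pow_right
  have hbc : 12 * (primeToProd p (p ^ (k + 1) * b) 0 * primeToProd p (p ^ (k + 1) * c) 0) ≡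
      12 * primeToProd p (p ^ (k + 1)) 0 ^ (b + c) [ZMOD ((p ^ (k + 1) : ℕ) : ℤ) ^ 3] := by
    have h1 := hb.mul_right (primeToProd p (p ^ (k + 1) * c) 0)
    have h2 := hc.mul_right (primeToProd p (p ^ (k + 1)) 0 ^ b)
    rw [← mul_assoc, pow_add _ b]
    refine h1.trans ?_
    convert h2 using 1 <;> ring
  have h1 := hbc.mul_left ((p ^ (k + 1) * (b + c)).choose (p ^ (k + 1) * b) : ℤ)
  have h2 := ha.mul_left ((p ^ k * (b + c)).choose (p ^ k * b) : ℤ)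
  rw [mul_left_comm, h, mul_left_comm] at h1
  have h3 := (h1.symm.trans h2).dvd
  apply Int.ModEq.symm
  rw [Int.modEq_iff_dvd, ← dvd_neg]
  refine hcop.dvd_of_dvd_mul_right (h3.trans (dvd_of_eq ?_))
  ring

theorem two_dvd_choose_add_choose (b c : ℕ) :
    (2 : ℤ) ∣ ((2 * (b + c)).choose (2 * b) : ℤ) + ((b + c).choose b : ℤ) := by
  have h := choose_mul_primeToProd 2 two_pos b c
  have hodd : ∀ n, ∃ u, primeToProd 2 n 0 = 2 * u + 1 := fun n => by
    have h2 : ¬ ((2 : ℕ) : ℤ) ∣ primeToProd 2 n 0 :=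
      (Nat.prime_iff_prime_int.mp Nat.prime_two).coprime_iff_not_dvd.mp
        (isCoprime_primeToProd 2 Nat.prime_two n 0 (dvd_zero _))
    exact ⟨primeToProd 2 n 0 / 2, by omega⟩
  obtain ⟨u, hu⟩ := hodd (2 * b)
  obtain ⟨v, hv⟩ := hodd (2 * c)
  obtain ⟨w, hw⟩ := hodd (2 * (b + c))
  rw [hu, hv, hw] at h
  refine ⟨(b + c).choose b * (1 + w) -
    (2 * (b + c)).choose (2 * b) * (2 * u * v + u + v), ?_⟩
  linear_combination h

theorem sum_divisors_coprime_mul {M : Type*} [AddCommMonoid M] {m n : ℕ} (h : m.Coprime n)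
    (f : ℕ → M) :
    ∑ d ∈ (m * n).divisors, f d = ∑ x ∈ m.divisors, ∑ y ∈ n.divisors, f (x * y) := by
  rw [Nat.divisors_mul, Finset.mul_def, Finset.sum_image, Finset.sum_product]
  intro x hx y hy hxy
  exact h.mul_injOn_divisors hx hy hxy

open ArithmeticFunction in
theorem sum_divisors_moebius_prime_pow_mul {p k n : ℕ} (hp : p.Prime) (hn : p.Coprime n) (f : ℕ → ℤ) :
    ∑ d ∈ (p ^ (k + 1) * n).divisors, moebius (p ^ (k + 1) * n / d) * f d =
      ∑ e ∈ n.divisors, moebius (n / e) * (f (p ^ (k + 1) * e) - f (p ^ k * e)) := by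
  have hμ : ∀ i ≤ k + 1, ∀ e ∈ n.divisors, moebius (p ^ (k + 1) * n / (p ^ i * e)) =
      moebius (p ^ (k + 1 - i)) * moebius (n / e) := by
    intro i hi e he
    have hen := Nat.dvd_of_mem_divisors he
    rw [Nat.mul_div_mul_comm (pow_dvd_pow p hi) hen, Nat.pow_div hi hp.pos]
    exact isMultiplicative_moebius.map_mul_of_coprime
      ((hn.coprime_dvd_right (Nat.div_dvd_of_dvd hen)).pow_left _)
  rw [sum_divisors_coprime_mul (hn.pow_left _), Nat.sum_divisors_prime_pow hp,
    Finset.sum_range_succ, Finset.sum_range_succ, Finset.sum_eq_zero, zero_add,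
    ← Finset.sum_add_distrib]
  · refine Finset.sum_congr rfl fun e he => ?_
    rw [hμ _ (Nat.le_succ k) e he, hμ _ le_rfl e he, Nat.sub_self, Nat.add_sub_cancel_left,
      pow_one, moebius_apply_prime hp, pow_zero, moebius_apply_one]
    ring
  · intro i hi
    have hi' := Finset.mem_range.mp hi
    refine Finset.sum_eq_zero fun e he => ?_
    rw [hμ i (by omega) e he, moebius_apply_prime_pow hp (by omega), if_neg (by omega)]
    ring

theorem prime_pow_dvd_signed_choose_sub {p k n : ℕ} (hp : p.Prime) (hn : p.Coprime n)
    (b c e : ℕ) (he : e ∣ n) :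
    ((p ^ (k + 1) : ℕ) : ℤ) ^ 3 ∣ 12 *
      ((-1) ^ (p ^ (k + 1) * n + p ^ (k + 1) * e) *
          (((b + c) * (p ^ (k + 1) * e)).choose (b * (p ^ (k + 1) * e)) : ℤ) -
        (-1) ^ (p ^ (k + 1) * n + p ^ k * e) *
          (((b + c) * (p ^ k * e)).choose (b * (p ^ k * e)) : ℤ)) := by
  have hre : ∀ x y : ℕ, x * (y * e) = y * (x * e) := fun x y => by ring
  simp only [hre b, hre (b + c), add_mul]
  by_cases hq : p ^ (k + 1) = 2
  · obtain ⟨rfl, rfl⟩ : p = 2 ∧ k = 0 := by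
      have h2 : p = 2 := (Nat.prime_dvd_prime_iff_eq hp Nat.prime_two).mp
        (hq ▸ dvd_pow_self p (Nat.succ_ne_zero k))
      subst h2
      exact ⟨rfl, by simpa using Nat.pow_right_injective le_rfl (hq.trans (pow_one 2).symm)⟩
    have hodd : Odd e := (Nat.coprime_two_left.mp hn).of_dvd_nat he
    have h1 : Even (2 ^ (0 + 1) * n + 2 ^ (0 + 1) * e) := ⟨n + e, by ring⟩
    have h2 : Odd (2 ^ (0 + 1) * n + 2 ^ 0 * e) := by
      rw [zero_add, pow_one, pow_zero, one_mul]
      exact (even_two_mul n).add_odd hodd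
    rw [h1.neg_one_pow, h2.neg_one_pow]
    obtain ⟨w, hw⟩ := two_dvd_choose_add_choose (b * e) (c * e)
    refine ⟨3 * w, ?_⟩
    simp only [zero_add, pow_one, pow_zero, one_mul]
    push_cast
    linear_combination 12 * hw
  · have hsign : ((-1 : ℤ)) ^ (p ^ (k + 1) * n + p ^ k * e) =
        (-1) ^ (p ^ (k + 1) * n + p ^ (k + 1) * e) := by
      have hpar : Even (p ^ k) ↔ Even (p ^ (k + 1)) := by
        simp only [Nat.even_pow, ne_eq, Nat.succ_ne_zero, not_false_eq_true, and_true,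
          and_iff_left_iff_imp]
        rintro h rfl
        exact hq (by rw [hp.even_iff.mp h]; rfl)
      apply neg_one_pow_congr
      simp only [Nat.even_add, Nat.even_mul, hpar]
    rw [hsign, ← mul_sub, mul_left_comm, mul_sub]
    exact (twelve_mul_choose_modEq p k hp hq (b * e) (c * e)).symm.dvd.mul_left _

theorem pow_dvd_of_forall_prime_pow_dvd {m r : ℕ} (hm : 0 < m) (X : ℤ)
    (h : ∀ p k n : ℕ, p.Prime → p.Coprime n → m = p ^ (k + 1) * n →
      ((p ^ (k + 1) : ℕ) : ℤ) ^ r ∣ X) : (m : ℤ) ^ r ∣ X := by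
  rw [← Nat.cast_pow, Int.natCast_dvd, Nat.dvd_iff_prime_pow_dvd_dvd]
  intro p j hp hj
  obtain ⟨k, n, hn, hmn⟩ := Nat.exists_eq_pow_mul_and_not_dvd hm.ne' p hp.ne_one
  have hcop : p.Coprime n := hp.coprime_iff_not_dvd.mpr hn
  rw [hmn, mul_pow] at hj
  have hj2 : p ^ j ∣ (p ^ k) ^ r :=
    Nat.Coprime.dvd_of_dvd_mul_right (hcop.pow _ _) hj
  refine hj2.trans ?_
  rw [← Int.natCast_dvd, Nat.cast_pow]
  cases k with
  | zero => simp
  | succ k => exact h p k n hp hcop hmn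


open ArithmeticFunction in
theorem stmt15 (m a b : ℕ) (hm : 0 < m) (hb : 0 < b) (hab : b < a) :
    (m : ℤ)^3 ∣ 12 * ∑ d ∈ m.divisors,
      (-1 : ℤ)^(m + d) * moebius (m / d) * (Nat.choose (a*d) (b*d) : ℤ) := by
  obtain ⟨c, rfl⟩ := Nat.exists_eq_add_of_lt hab
  rw [add_assoc]
  refine pow_dvd_of_forall_prime_pow_dvd hm _ fun p k n hp hn hmn => ?_
  have hsum := sum_divisors_moebius_prime_pow_mul (k := k) hp hn
    (fun d => (-1) ^ (m + d) * (((b + (c + 1)) * d).choose (b * d) : ℤ))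
  rw [← hmn] at hsum
  have hcomm : ∀ d, (-1 : ℤ) ^ (m + d) * moebius (m / d) *
      (((b + (c + 1)) * d).choose (b * d) : ℤ) =
      moebius (m / d) * ((-1) ^ (m + d) * (((b + (c + 1)) * d).choose (b * d) : ℤ)) :=
    fun d => by ring
  simp only [hcomm]
  rw [hsum, Finset.mul_sum]
  refine Finset.dvd_sum fun e he => ?_
  rw [mul_left_comm, hmn]
  exact (prime_pow_dvd_signed_choose_sub hp hn b (c + 1) e
    (Nat.dvd_of_mem_divisors he)).mul_left _
end
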